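/- Let Ψ be a planar-monotone-style CNF instance with n variables in which every clause has |L_h| ∈ {2,3}, and let G'_Ψ be the associated power-domination graph. Then every power dominating set of G'_Ψ has cardinality at least n. -/

import Mathlib

/-- A planar-monotone-style CNF instance with `n` variables and `m` clauses:
clause `h` consists of the set of variable indices `L h` together with a sign
`eps h` (`true` = all literals unnegated, `false` = all negated). -/
structure PMCnf (n m : ℕ) where
  L : Fin m → Finset (Fin n)
  eps : Fin m → Bool

/-- An assignment `a` satisfies `Ψ` if every clause contains a variable whose
value agrees with the sign of the clause. -/
def PMCnf.Satisfies {n m : ℕ} (Ψ : PMCnf n m) (a : Fin n → Bool) : Prop :=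
  ∀ h : Fin m, ∃ i ∈ Ψ.L h, a i = Ψ.eps h

/-- The closed neighborhood `Γ(S)` of a set of vertices. -/
def closedNbhd {V : Type*} (G : SimpleGraph V) (S : Set V) : Set V :=
  S ∪ {v | ∃ s ∈ S, G.Adj v s}

/-- `S` is a dominating set if `Γ(S) = V`. -/
def IsDominating {V : Type*} (G : SimpleGraph V) (S : Set V) : Prop :=
  closedNbhd G S = Set.univ

/-- `S₁(A)`: the vertices of `A` having exactly one neighbor outside `A`. -/
def pdS1 {V : Type*} (G : SimpleGraph V) (A : Set V) : Set V :=
  {s ∈ A | ∃! v, v ∉ A ∧ G.Adj s v}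

/-- The propagation operator `Γ₁(A) = A ∪ Γ(S₁(A))`. -/
def pdStep {V : Type*} (G : SimpleGraph V) (A : Set V) : Set V :=
  A ∪ closedNbhd G (pdS1 G A)

/-- `S` is a power dominating set if iterating `Γ₁` starting from `Γ(S)`
eventually covers all vertices. -/
def IsPowerDominating {V : Type*} (G : SimpleGraph V) (S : Set V) : Prop :=
  ∃ k : ℕ, (pdStep G)^[k] (closedNbhd G S) = Set.univ

/-- Validity predicate for clause-gadget vertices of `G'_Ψ`: `(h, Sum.inl l)`
is the vertex `z_{h,l}` (requires `l ∈ L h`), and `(h, Sum.inr 0)`,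
`(h, Sum.inr 1)` are the vertices `z_{h,h}`, `v_{h,h}` (present only when
clause `h` has exactly two literals). -/
def ClauseOk {n m : ℕ} (Ψ : PMCnf n m) : Fin m × (Fin n ⊕ Fin 2) → Prop
  | (h, Sum.inl l) => l ∈ Ψ.L h
  | (h, Sum.inr _) => (Ψ.L h).card = 2

/-- Vertices of the power-domination graph `G'_Ψ`: for each variable `i` the
six vertices `v_i = (i,0)`, `v̄_i = (i,1)`, `u_i = (i,2)`, `v'_i = (i,3)`,
`v̄'_i = (i,4)`, `u'_i = (i,5)`, together with the clause-gadget vertices. -/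
abbrev PVert {n m : ℕ} (Ψ : PMCnf n m) :=
  (Fin n × Fin 6) ⊕ {p : Fin m × (Fin n ⊕ Fin 2) // ClauseOk Ψ p}

/-- The base relation generating the edges of `G'_Ψ`.
* Within a variable gadget, `(i,a)` and `(i,b)` are adjacent iff
  `a ≢ b (mod 3)`, i.e. all pairs except `(v_i,v'_i)`, `(v̄_i,v̄'_i)`,
  `(u_i,u'_i)` (and loops) are edges.
* A clause-gadget vertex of clause `h` with slot `q` is adjacent to the
  literal vertex `w_i` (`= v_i` or `v̄_i` according to `eps h`) for each
  `i ∈ L h`, except that `z_{h,l}` is not adjacent to `w_l` itself.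
* Two clause-gadget vertices are adjacent iff they belong to the same clause,
  are distinct, and are not the pair `(z_{h,h}, v_{h,h})`. -/
def pdRel {n m : ℕ} (Ψ : PMCnf n m) : PVert Ψ → PVert Ψ → Prop
  | Sum.inl (i, a), Sum.inl (j, b) => i = j ∧ a.val % 3 ≠ b.val % 3
  | Sum.inl (i, a), Sum.inr ⟨(h, q), _⟩ =>
      a = (if Ψ.eps h then 0 else 1) ∧ i ∈ Ψ.L h ∧ ∀ l, q = Sum.inl l → l ≠ i
  | Sum.inr ⟨(h, q), _⟩, Sum.inl (i, a) =>
      a = (if Ψ.eps h then 0 else 1) ∧ i ∈ Ψ.L h ∧ ∀ l, q = Sum.inl l → l ≠ i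
  | Sum.inr ⟨(h, q), _⟩, Sum.inr ⟨(h', q'), _⟩ =>
      h = h' ∧ q ≠ q' ∧ (q.isLeft = true ∨ q'.isLeft = true)

/-- The power-domination graph `G'_Ψ` associated to the CNF instance `Ψ`. -/
def pdGraph {n m : ℕ} (Ψ : PMCnf n m) : SimpleGraph (PVert Ψ) :=
  SimpleGraph.fromRel (pdRel Ψ)

/-- The literal vertex `w_l` of clause `h`: `v_l` if `eps h = true`,
`v̄_l` if `eps h = false`. -/
def wV {n m : ℕ} (Ψ : PMCnf n m) (h : Fin m) (l : Fin n) : PVert Ψ :=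
  Sum.inl (l, if Ψ.eps h then 0 else 1)

/-- The clause-gadget vertex `z_{h,l}` (for `l ∈ L h`). -/
def zV {n m : ℕ} (Ψ : PMCnf n m) (h : Fin m) (l : Fin n) (hl : l ∈ Ψ.L h) :
    PVert Ψ :=
  Sum.inr ⟨(h, Sum.inl l), hl⟩

/-- The clause-gadget vertex `z_{h,h}` (for a clause with two literals). -/
def zhhV {n m : ℕ} (Ψ : PMCnf n m) (h : Fin m) (hc : (Ψ.L h).card = 2) :
    PVert Ψ :=
  Sum.inr ⟨(h, Sum.inr 0), hc⟩

/-- The clause-gadget vertex `v_{h,h}` (for a clause with two literals). -/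
def vhhV {n m : ℕ} (Ψ : PMCnf n m) (h : Fin m) (hc : (Ψ.L h).card = 2) :
    PVert Ψ :=
  Sum.inr ⟨(h, Sum.inr 1), hc⟩

/-- If two distinct vertices have the same neighbors and neither is observed, then neither becomes
observed in a propagation step. -/
theorem notMem_pdStep_of_twins {V : Type*} {G : SimpleGraph V} {u u' : V} (hne : u ≠ u')
    (htw : ∀ x, G.Adj x u ↔ G.Adj x u') {A : Set V} (hu : u ∉ A) (hu' : u' ∉ A) :
    u ∉ pdStep G A ∧ u' ∉ pdStep G A := by
  have not_unique (s : V) (hs : s ∈ pdS1 G A) : ¬ G.Adj s u := fun hadj =>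
    hne (hs.2.unique ⟨hu, hadj⟩ ⟨hu', (htw s).1 hadj⟩)
  constructor
  · rintro (h | h | ⟨s, hs, hadj⟩)
    · exact hu h
    · exact hu h.1
    · exact not_unique s hs hadj.symm
  · rintro (h | h | ⟨s, hs, hadj⟩)
    · exact hu' h
    · exact hu' h.1
    · exact not_unique s hs ((htw s).2 hadj.symm)

/-- A power dominating set meets the closed neighborhood of any pair of twin vertices. -/
theorem IsPowerDominating.mem_closedNbhd_of_twins {V : Type*} {G : SimpleGraph V} {S : Set V}
    (hS : IsPowerDominating G S) {u u' : V} (hne : u ≠ u')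
    (htw : ∀ x, G.Adj x u ↔ G.Adj x u') : u ∈ closedNbhd G S ∨ u' ∈ closedNbhd G S := by
  by_contra! hA
  obtain ⟨k, hk⟩ := hS
  have unobserved (j : ℕ) : u ∉ (pdStep G)^[j] (closedNbhd G S) ∧
      u' ∉ (pdStep G)^[j] (closedNbhd G S) := by
    induction j with
    | zero => exact hA
    | succ j ih =>
      rw [Function.iterate_succ_apply']
      exact notMem_pdStep_of_twins hne htw ih.1 ih.2
  exact (unobserved k).1 (hk ▸ Set.mem_univ u)

theorem pdGraph_adj_u_iff {n m : ℕ} (Ψ : PMCnf n m) (i : Fin n) (b : Fin 6) (hb : b.val % 3 = 2)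
    (x : PVert Ψ) :
    (pdGraph Ψ).Adj x (Sum.inl (i, b)) ↔ ∃ a : Fin 6, a.val % 3 ≠ 2 ∧ x = Sum.inl (i, a) := by
  rw [pdGraph, SimpleGraph.fromRel_adj]
  rcases x with ⟨j, a⟩ | ⟨⟨h, q⟩, hq⟩
  · simp only [pdRel, hb]
    constructor
    · rintro ⟨-, ⟨rfl, h⟩ | ⟨rfl, h⟩⟩
      · exact ⟨a, h, rfl⟩
      · exact ⟨a, h.symm, rfl⟩
    · rintro ⟨c, hc, hx⟩
      obtain ⟨rfl, rfl⟩ := Prod.mk.inj (Sum.inl.inj hx)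
      refine ⟨fun he => hc ?_, Or.inl ⟨rfl, hc⟩⟩
      rw [(Prod.mk.inj (Sum.inl.inj he)).2, hb]
  · have hne : b ≠ if Ψ.eps h then 0 else 1 := by
      rintro rfl
      split_ifs at hb <;> simp at hb
    simp [pdRel, hne]

/-- Every power dominating set contains a vertex of each variable gadget. -/
theorem IsPowerDominating.exists_mem_gadget {n m : ℕ} {Ψ : PMCnf n m} {S : Set (PVert Ψ)}
    (hS : IsPowerDominating (pdGraph Ψ) S) (i : Fin n) : ∃ a : Fin 6, Sum.inl (i, a) ∈ S := by
  have of_u_mem (b : Fin 6) (hb : b.val % 3 = 2)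
      (h : Sum.inl (i, b) ∈ closedNbhd (pdGraph Ψ) S) : ∃ a : Fin 6, Sum.inl (i, a) ∈ S := by
    rcases h with h | ⟨s, hs, hadj⟩
    · exact ⟨b, h⟩
    · obtain ⟨a, -, rfl⟩ := (pdGraph_adj_u_iff Ψ i b hb s).1 hadj.symm
      exact ⟨a, hs⟩
  rcases hS.mem_closedNbhd_of_twins (u := Sum.inl (i, 2)) (u' := Sum.inl (i, 5)) (by simp)
    (fun x => by rw [pdGraph_adj_u_iff Ψ i 2 rfl, pdGraph_adj_u_iff Ψ i 5 rfl]) with h | h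
  · exact of_u_mem 2 rfl h
  · exact of_u_mem 5 rfl h

/-- Every power dominating set of `G'_Ψ` has cardinality at
least `n`. -/
theorem pdGraph_powerDominating_card_ge {n m : ℕ} (Ψ : PMCnf n m)
    (hsz : ∀ h : Fin m, (Ψ.L h).card = 2 ∨ (Ψ.L h).card = 3)
    (S : Set (PVert Ψ)) (hS : IsPowerDominating (pdGraph Ψ) S) :
    n ≤ S.ncard := by
  choose f hf using hS.exists_mem_gadget
  have hinj : Function.Injective fun i : Fin n => (⟨Sum.inl (i, f i), hf i⟩ : S) := fun i j h =>
    (Prod.mk.inj (Sum.inl.inj (Subtype.mk.inj h))).1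
  rw [← Nat.card_coe_set_eq]
  simpa using Nat.card_le_card_of_injective _ hinj
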